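/- Consider a weighted labelled transition system (WLTS) given by a type S of states, a type A of actions, a deterministic partial transition function step : S → A → Option S, and a weight function w : S → ℝ with 0 ≤ w s ≤ 1 for all s. Let t, s ∈ S and let ε ∈ ℝ with 0 ≤ ε ≤ 1. Then there exists an ε-bisimulation relating t and s if and only if t and s have the same set of admissible traces and for every trace T, |Pr(T, t) − Pr(T, s)| ≤ ε. In particular, when t and s have the same admissible traces, the bisimulation distance between t and s equals sup over traces T of |Pr(T, t) − Pr(T, s)|. -/

import Mathlib

/-- `R` is an ε-bisimulation on the WLTS given by `step` and `w`. -/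
def IsEpsBisim {S A : Type*} (step : S → A → Option S) (w : S → ℝ) (ε : ℝ)
    (R : S → S → Prop) : Prop :=
  (∀ s, R s s) ∧ (∀ t s, R t s → R s t) ∧
  ∀ t s, R t s →
    (∀ a u, step t a = some u → ∃ v, step s a = some v ∧ R u v) ∧
    |w t - w s| ≤ ε

/-- Running a trace (a list of actions) from a state. -/
def runTrace {S A : Type*} (step : S → A → Option S) : S → List A → Option S
  | t, [] => some t
  | t, a :: T => (step t a).bind fun u => runTrace step u T

/-- The success probability of a trace from a state (0 if not admissible). -/
def prTrace {S A : Type*} (step : S → A → Option S) (w : S → ℝ)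
    (t : S) (T : List A) : ℝ :=
  (runTrace step t T).elim 0 w

/-- `t` and `s` have the same admissible traces, with success probabilities within `ε`. -/
def TraceClose {S A : Type*} (step : S → A → Option S) (w : S → ℝ) (ε : ℝ) (t s : S) : Prop :=
  (∀ T : List A, (runTrace step t T).isSome ↔ (runTrace step s T).isSome) ∧
    ∀ T : List A, |prTrace step w t T - prTrace step w s T| ≤ ε

theorem runTrace_cons_of_step {S A : Type*} {step : S → A → Option S} {t u : S} {a : A}
    (h : step t a = some u) (T : List A) : runTrace step t (a :: T) = runTrace step u T := by
  simp [runTrace, h]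

theorem isEpsBisim_traceClose {S A : Type*} (step : S → A → Option S) (w : S → ℝ) {ε : ℝ}
    (hε : 0 ≤ ε) : IsEpsBisim step w ε (TraceClose step w ε) := by
  refine ⟨fun s => ⟨fun T => Iff.rfl, fun T => by simpa using hε⟩,
    fun t s h => ⟨fun T => (h.1 T).symm, fun T => by rw [abs_sub_comm]; exact h.2 T⟩,
    fun t s h => ⟨fun a u hu => ?_, h.2 []⟩⟩
  have ha : (step s a).isSome := by simpa [runTrace, hu] using h.1 [a]
  obtain ⟨v, hv⟩ := Option.isSome_iff_exists.mp ha
  refine ⟨v, hv, fun T => ?_, fun T => ?_⟩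
  · simpa only [runTrace_cons_of_step hu, runTrace_cons_of_step hv] using h.1 (a :: T)
  · simpa only [prTrace, runTrace_cons_of_step hu, runTrace_cons_of_step hv] using h.2 (a :: T)

theorem IsEpsBisim.exists_runTrace {S A : Type*} {step : S → A → Option S} {w : S → ℝ} {ε : ℝ}
    {R : S → S → Prop} (hR : IsEpsBisim step w ε R) (T : List A) {t s u : S} (h : R t s)
    (hu : runTrace step t T = some u) : ∃ v, runTrace step s T = some v ∧ R u v := by
  induction T generalizing t s with
  | nil =>
    obtain rfl : t = u := by simpa [runTrace] using hu
    exact ⟨s, rfl, h⟩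
  | cons a T ih =>
    obtain ⟨t', ht', hu'⟩ := Option.bind_eq_some_iff.mp hu
    obtain ⟨s', hs', h'⟩ := (hR.2.2 t s h).1 a t' ht'
    rw [runTrace_cons_of_step hs']
    exact ih h' hu'

theorem IsEpsBisim.traceClose {S A : Type*} {step : S → A → Option S} {w : S → ℝ} {ε : ℝ}
    (hε : 0 ≤ ε) {R : S → S → Prop} (hR : IsEpsBisim step w ε R) {t s : S} (h : R t s) :
    TraceClose step w ε t s := by
  have key : ∀ {t s : S}, R t s → ∀ T : List A,
      (runTrace step t T).isSome → (runTrace step s T).isSome := by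
    intro t s h T ht
    obtain ⟨u, hu⟩ := Option.isSome_iff_exists.mp ht
    obtain ⟨v, hv, -⟩ := hR.exists_runTrace T h hu
    simp [hv]
  have hiff : ∀ T : List A, (runTrace step t T).isSome ↔ (runTrace step s T).isSome :=
    fun T => ⟨key h T, key (hR.2.1 _ _ h) T⟩
  refine ⟨hiff, fun T => ?_⟩
  cases ht : runTrace step t T with
  | none =>
    have hs : runTrace step s T = none := by simpa [ht] using hiff T
    simpa [prTrace, ht, hs] using hε
  | some u =>
    obtain ⟨v, hv, huv⟩ := hR.exists_runTrace T h ht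
    simpa [prTrace, ht, hv] using (hR.2.2 u v huv).2

theorem exists_isEpsBisim_iff {S A : Type*} (step : S → A → Option S) (w : S → ℝ) {ε : ℝ}
    (hε : 0 ≤ ε) (t s : S) :
    (∃ R, IsEpsBisim step w ε R ∧ R t s) ↔ TraceClose step w ε t s :=
  ⟨fun ⟨_, hR, h⟩ => hR.traceClose hε h, fun h => ⟨_, isEpsBisim_traceClose step w hε, h⟩⟩

theorem prTrace_mem_Icc {S A : Type*} (step : S → A → Option S) {w : S → ℝ}
    (hw : ∀ s, 0 ≤ w s ∧ w s ≤ 1) (t : S) (T : List A) :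
    0 ≤ prTrace step w t T ∧ prTrace step w t T ≤ 1 := by
  unfold prTrace
  cases runTrace step t T with
  | none => simp
  | some u => exact hw u

theorem abs_prTrace_sub_le_one {S A : Type*} (step : S → A → Option S) {w : S → ℝ}
    (hw : ∀ s, 0 ≤ w s ∧ w s ≤ 1) (t s : S) (T : List A) :
    |prTrace step w t T - prTrace step w s T| ≤ 1 := by
  have h₁ := prTrace_mem_Icc step hw t T
  have h₂ := prTrace_mem_Icc step hw s T
  rw [abs_le]
  constructor <;> linarith

theorem bisim_iff_traces {S A : Type*} (step : S → A → Option S) (w : S → ℝ)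
    (hw : ∀ s, 0 ≤ w s ∧ w s ≤ 1) (t s : S) (ε : ℝ) (hε0 : 0 ≤ ε) (hε1 : ε ≤ 1) :
    ((∃ R, IsEpsBisim step w ε R ∧ R t s) ↔
      ((∀ T : List A, (runTrace step t T).isSome ↔ (runTrace step s T).isSome) ∧
        ∀ T : List A, |prTrace step w t T - prTrace step w s T| ≤ ε)) ∧
    ((∀ T : List A, (runTrace step t T).isSome ↔ (runTrace step s T).isSome) →
      sInf {ε' : ℝ | 0 ≤ ε' ∧ ε' ≤ 1 ∧ ∃ R, IsEpsBisim step w ε' R ∧ R t s} =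
        ⨆ T : List A, |prTrace step w t T - prTrace step w s T|) := by
  refine ⟨exists_isEpsBisim_iff step w hε0 t s, fun hadm => IsLeast.csInf_eq ⟨?_, ?_⟩⟩
  · have h0 : 0 ≤ ⨆ T : List A, |prTrace step w t T - prTrace step w s T| :=
      Real.iSup_nonneg fun T => abs_nonneg _
    have hbdd : BddAbove (Set.range fun T : List A => |prTrace step w t T - prTrace step w s T|) :=
      ⟨1, Set.forall_mem_range.mpr (abs_prTrace_sub_le_one step hw t s)⟩
    exact ⟨h0, ciSup_le (abs_prTrace_sub_le_one step hw t s),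
      (exists_isEpsBisim_iff step w h0 t s).mpr ⟨hadm, le_ciSup hbdd⟩⟩
  · rintro ε' ⟨h0, -, h⟩
    exact ciSup_le ((exists_isEpsBisim_iff step w h0 t s).mp h).2
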